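/- Let A := {(x_1, x_2) ∈ ℝ² : 1 − x_1·x_2 ≤ 0, −x_1 ≤ 0, −x_2 ≤ 0}. Then A is not a basic semi-algebraic convex set; that is, there do not exist a positive integer l and convex polynomials g_1, …, g_l on ℝ² such that A = {x ∈ ℝ² : g_i(x) ≤ 0 for all i = 1, …, l}. -/

import Mathlib

open Metric Set
open scoped BigOperators

noncomputable section

/-- Restricting a bivariate polynomial to the hyperbola `x₁x₂ = 1` and clearing denominators yields
a univariate polynomial. -/
lemma exists_polynomial_eval_hyperbola (p : MvPolynomial (Fin 2) ℝ) :
    ∃ (q : Polynomial ℝ) (N : ℕ), ∀ t : ℝ, t ≠ 0 →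
      q.eval t = t ^ N * MvPolynomial.eval ![t, t⁻¹] p := by
  induction p using MvPolynomial.induction_on with
  | C a => exact ⟨Polynomial.C a, 0, fun t _ => by simp⟩
  | add p₁ p₂ h₁ h₂ =>
    obtain ⟨q₁, N₁, h₁⟩ := h₁
    obtain ⟨q₂, N₂, h₂⟩ := h₂
    refine ⟨Polynomial.X ^ N₂ * q₁ + Polynomial.X ^ N₁ * q₂, N₁ + N₂, fun t ht => ?_⟩
    simp only [Polynomial.eval_add, Polynomial.eval_mul, Polynomial.eval_pow, Polynomial.eval_X,
      map_add, h₁ t ht, h₂ t ht]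
    ring
  | mul_X p i h =>
    obtain ⟨q, N, h⟩ := h
    fin_cases i
    · refine ⟨q * Polynomial.X, N, fun t ht => ?_⟩
      simp [h t ht, mul_assoc]
    · refine ⟨q, N + 1, fun t ht => ?_⟩
      simp only [h t ht, Fin.mk_one, map_mul, MvPolynomial.eval_X, Matrix.cons_val_one,
        Matrix.cons_val_fin_one]
      rw [pow_succ, mul_mul_mul_comm, mul_inv_cancel₀ ht, mul_one]

/-- For finitely many real polynomials there is a positive real number that is a root of none of the
nonzero ones. -/
lemma exists_pos_forall_eval_ne_zero {ι : Type*} [Finite ι] (q : ι → Polynomial ℝ) :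
    ∃ t : ℝ, 0 < t ∧ ∀ i, q i ≠ 0 → (q i).eval t ≠ 0 := by
  have hfin : (⋃ i, ((q i).roots.toFinset : Set ℝ)).Finite :=
    Set.finite_iUnion fun i => Finset.finite_toSet _
  obtain ⟨t, ht, htn⟩ := ((Set.Ioi_infinite (0 : ℝ)).sdiff hfin).nonempty
  refine ⟨t, ht, fun i hi h0 => htn (Set.mem_iUnion.2 ⟨i, ?_⟩)⟩
  simpa [hi] using h0

/-- A convex function that is nonpositive at `x` and `-x` is nonpositive at every `r • x` with
`r ∈ [-1, 1]`. -/
lemma ConvexOn.smul_nonpos {E : Type*} [AddCommGroup E] [Module ℝ E] {f : E → ℝ}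
    (hf : ConvexOn ℝ Set.univ f) {x : E} (hx : f x ≤ 0) (hnx : f (-x) ≤ 0) {r : ℝ}
    (hr : r ∈ Set.Icc (-1) 1) : f (r • x) ≤ 0 := by
  have h := hf.2 (Set.mem_univ x) (Set.mem_univ (-x))
    (show 0 ≤ (1 + r) / 2 by linarith [hr.1]) (show 0 ≤ (1 - r) / 2 by linarith [hr.2]) (by ring)
  have hcomb : ((1 + r) / 2) • x + ((1 - r) / 2) • (-x) = r • x := by module
  rw [hcomb, smul_eq_mul, smul_eq_mul] at h
  nlinarith [hr.1, hr.2]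

/-- The convex semi-algebraic set `{(x₁,x₂) : 1 - x₁x₂ ≤ 0, -x₁ ≤ 0, -x₂ ≤ 0}` is not
a basic semi-algebraic convex set (Example 2.13). -/
theorem not_basic_semialgebraic_convex_example :
    ¬ ∃ (l : ℕ) (_ : 0 < l) (g : Fin l → EuclideanSpace ℝ (Fin 2) → ℝ),
      (∀ i, (∃ p : MvPolynomial (Fin 2) ℝ,
          ∀ x : EuclideanSpace ℝ (Fin 2), g i x = MvPolynomial.eval (fun j => x j) p) ∧
        ConvexOn ℝ Set.univ (g i)) ∧
      {x : EuclideanSpace ℝ (Fin 2) | 1 - x 0 * x 1 ≤ 0 ∧ -x 0 ≤ 0 ∧ -x 1 ≤ 0} =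
        {x : EuclideanSpace ℝ (Fin 2) | ∀ i, g i x ≤ 0} := by
  rintro ⟨l, -, g, hg, hA⟩
  choose p hp using fun i => (hg i).1
  choose q N hq using fun i => exists_polynomial_eval_hyperbola (p i)
  obtain ⟨t, ht, hne⟩ := exists_pos_forall_eval_ne_zero q
  have hval : ∀ i (s : ℝ), g i !₂[s, s⁻¹] = MvPolynomial.eval ![s, s⁻¹] (p i) := by
    intro i s
    rw [hp]
  have hle : ∀ i, g i !₂[t, t⁻¹] ≤ 0 := by
    have hmem : !₂[t, t⁻¹] ∈ {x : EuclideanSpace ℝ (Fin 2) | ∀ i, g i x ≤ 0} := by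
      rw [← hA]
      simp [ht.le, ht.ne']
    exact hmem
  have hev : ∀ᶠ r : ℝ in nhdsWithin 1 (Set.Iio 1), ∀ i, g i (r • !₂[t, t⁻¹]) ≤ 0 := by
    rw [Filter.eventually_all]
    intro i
    by_cases hi : q i = 0
    · have hneg : -!₂[t, t⁻¹] = !₂[-t, (-t)⁻¹] := by
        ext j
        fin_cases j <;> simp [inv_neg]
      have hzero : g i (-!₂[t, t⁻¹]) = 0 := by
        have h := hq i (-t) (neg_ne_zero.2 ht.ne')
        rw [hi, Polynomial.eval_zero] at h
        rw [hneg, hval]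
        exact (mul_eq_zero.1 h.symm).resolve_left (pow_ne_zero _ (neg_ne_zero.2 ht.ne'))
      filter_upwards [Ioo_mem_nhdsLT (show (-1 : ℝ) < 1 by norm_num)] with r hr
      exact (hg i).2.smul_nonpos (hle i) hzero.le (Set.Ioo_subset_Icc_self hr)
    · have hlt : g i ((1 : ℝ) • !₂[t, t⁻¹]) < 0 := by
        rw [one_smul]
        refine (hle i).lt_of_ne fun h0 => hne i hi ?_
        rw [hq i t ht.ne', ← hval, h0, mul_zero]
      have hcont : Continuous fun r : ℝ => g i (r • !₂[t, t⁻¹]) := by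
        simp only [hp]
        exact (MvPolynomial.continuous_eval (p i)).comp (by fun_prop)
      filter_upwards [nhdsWithin_le_nhds (hcont.continuousAt.eventually_lt_const hlt)] with r hr
      exact hr.le
  obtain ⟨r, hr, hr01⟩ := (hev.and (Ioo_mem_nhdsLT (show (0 : ℝ) < 1 by norm_num))).exists
  have hmem : r • !₂[t, t⁻¹] ∈ {x : EuclideanSpace ℝ (Fin 2) | ∀ i, g i x ≤ 0} := hr
  rw [← hA] at hmem
  have h := hmem.1
  have hprod : r * t * (r * t⁻¹) = r ^ 2 := by field_simp
  simp only [PiLp.smul_apply, smul_eq_mul, Matrix.cons_val_zero,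
    Matrix.cons_val_one, Matrix.cons_val_fin_one, hprod] at h
  nlinarith [hr01.1, hr01.2]
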